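/- Let δ > 0 and Q = (-δ, δ) × 𝕋¹ with coordinates (r,s). There exists C > 0 such that for every u ∈ H¹(Q), ‖u‖_{L³(Q)}³ ≤ C (‖u‖_{L²(Q)} + ‖∂_r u‖_{L²(Q)})^{1/2} (‖u‖_{L²(Q)} + ‖∂_s u‖_{L²(Q)}) ‖u‖_{L²(Q)}^{3/2}. -/

import Mathlib

open MeasureTheory Real Filter

def Qset (δ : ℝ) : Set (ℝ × ℝ) := (Set.Ioo (-δ) δ) ×ˢ (Set.Ioo (0 : ℝ) 1)

/-- The Cauchy–Schwarz inequality for real square-integrable functions. -/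
lemma integral_abs_mul_le_sqrt_mul_sqrt {α : Type*} [MeasurableSpace α] {μ : Measure α}
    {f g : α → ℝ} (hf : MemLp f 2 μ) (hg : MemLp g 2 μ) :
    ∫ x, |f x * g x| ∂μ ≤ √(∫ x, f x ^ 2 ∂μ) * √(∫ x, g x ^ 2 ∂μ) := by
  have h := integral_mul_norm_le_Lp_mul_Lq (μ := μ) (f := f) (g := g) (p := 2) (q := 2)
    Real.HolderConjugate.two_two (by simpa using hf) (by simpa using hg)
  simpa [abs_mul, Real.sqrt_eq_rpow] using h

/-- A one-dimensional Sobolev bound: a `C¹` function on `[a, b]` is at most its mean plus the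
integral of the absolute value of its derivative. -/
lemma le_mean_add_integral_abs_deriv {f f' : ℝ → ℝ} {a b x : ℝ} (hab : a < b)
    (hx : x ∈ Set.Icc a b) (hf : ∀ y, HasDerivAt f (f' y) y) (hf' : Continuous f') :
    f x ≤ (b - a)⁻¹ * (∫ y in a..b, f y) + ∫ y in a..b, |f' y| := by
  have hfc : Continuous f := continuous_iff_continuousAt.2 fun y => (hf y).continuousAt
  set J := ∫ y in a..b, |f' y|
  have hle : ∀ y ∈ Set.Icc a b, f x - J ≤ f y := by
    intro y hy
    have h1 : ∫ t in y..x, f' t = f x - f y :=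
      intervalIntegral.integral_eq_sub_of_hasDerivAt (fun t _ => hf t)
        (hf'.intervalIntegrable _ _)
    have h2 : |∫ t in y..x, f' t| ≤ |(∫ t in y..x, |f' t|)| := by
      simpa only [← Real.norm_eq_abs] using
        intervalIntegral.norm_integral_le_abs_integral_norm (f := f') (μ := volume)
    have h3 : |(∫ t in y..x, |f' t|)| ≤ |(∫ t in a..b, |f' t|)| := by
      refine intervalIntegral.abs_integral_mono_interval ?_
        (Eventually.of_forall fun t => abs_nonneg _) (hf'.abs.intervalIntegrable _ _)
      rw [Set.uIoc_of_le hab.le]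
      exact Set.Ioc_subset_Ioc (le_min hy.1 hx.1) (max_le hy.2 hx.2)
    rw [abs_of_nonneg (intervalIntegral.integral_nonneg hab.le fun t _ => abs_nonneg (f' t))] at h3
    have := le_abs_self (∫ t in y..x, f' t)
    linarith
  have hmono := intervalIntegral.integral_mono_on hab.le (intervalIntegrable_const (c := f x - J))
    (hfc.intervalIntegrable (μ := volume) a b) hle
  rw [intervalIntegral.integral_const, smul_eq_mul] at hmono
  have hpos : 0 < b - a := sub_pos.2 hab
  have : f x - J ≤ (b - a)⁻¹ * ∫ y in a..b, f y := by
    rwa [inv_mul_eq_div, le_div_iff₀ hpos, mul_comm]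
  linarith

lemma Continuous.integrableOn_Qset {g : ℝ × ℝ → ℝ} (hg : Continuous g) (δ : ℝ) :
    IntegrableOn g (Qset δ) :=
  (hg.continuousOn.integrableOn_compact (isCompact_Icc.prod isCompact_Icc)).mono_set
    (Set.prod_mono Set.Ioo_subset_Icc_self Set.Ioo_subset_Icc_self)

lemma Continuous.memLp_two_Qset {g : ℝ × ℝ → ℝ} (hg : Continuous g) (δ : ℝ) :
    MemLp g 2 (volume.restrict (Qset δ)) :=
  (memLp_two_iff_integrable_sq hg.aestronglyMeasurable).2 ((hg.pow 2).integrableOn_Qset δ)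

lemma Continuous.memLp_two_Ioc {g : ℝ → ℝ} (hg : Continuous g) (a b : ℝ) :
    MemLp g 2 (volume.restrict (Set.Ioc a b)) :=
  (memLp_two_iff_integrable_sq hg.aestronglyMeasurable).2 ((hg.pow 2).integrableOn_Ioc)

lemma setIntegral_Qset {g : ℝ × ℝ → ℝ} (hg : Continuous g) {δ : ℝ} (hδ : 0 < δ) :
    ∫ p in Qset δ, g p = ∫ r in (-δ)..δ, ∫ s in (0 : ℝ)..1, g (r, s) := by
  have h := hg.integrableOn_Qset δ
  rw [Qset, Measure.volume_eq_prod] at *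
  rw [setIntegral_prod _ h, intervalIntegral.integral_of_le (by linarith),
    integral_Ioc_eq_integral_Ioo]
  simp only [intervalIntegral.integral_of_le zero_le_one, integral_Ioc_eq_integral_Ioo]

lemma setIntegral_Qset_symm {g : ℝ × ℝ → ℝ} (hg : Continuous g) {δ : ℝ} (hδ : 0 < δ) :
    ∫ p in Qset δ, g p = ∫ s in (0 : ℝ)..1, ∫ r in (-δ)..δ, g (r, s) := by
  have h := hg.integrableOn_Qset δ
  rw [Qset, Measure.volume_eq_prod] at *
  rw [IntegrableOn, ← Measure.prod_restrict] at h
  rw [← Measure.prod_restrict, integral_prod_symm _ h, intervalIntegral.integral_of_le zero_le_one,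
    integral_Ioc_eq_integral_Ioo]
  have hle : -δ ≤ δ := by linarith
  simp only [intervalIntegral.integral_of_le hle, integral_Ioc_eq_integral_Ioo]

/-- Bound for the `L²` norm of a slice `{r} × (0, 1)` by norms on the whole of `Qset δ`. -/
lemma integral_slice_sq_le {U V : ℝ × ℝ → ℝ} (hU : Continuous U) (hV : Continuous V)
    (hUV : ∀ r s, HasDerivAt (fun r => U (r, s)) (V (r, s)) r) {δ r : ℝ} (hδ : 0 < δ)
    (hr : r ∈ Set.Icc (-δ) δ) :
    ∫ s in (0 : ℝ)..1, U (r, s) ^ 2 ≤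
      (2 * δ)⁻¹ * (∫ p in Qset δ, U p ^ 2) +
        2 * (√(∫ p in Qset δ, U p ^ 2) * √(∫ p in Qset δ, V p ^ 2)) := by
  have hslice : ∀ s, U (r, s) ^ 2 ≤ (2 * δ)⁻¹ * (∫ r in (-δ)..δ, U (r, s) ^ 2) +
      2 * ∫ r in (-δ)..δ, |U (r, s) * V (r, s)| := by
    intro s
    have h := le_mean_add_integral_abs_deriv (f := fun r => U (r, s) ^ 2)
      (f' := fun r => 2 * (U (r, s) * V (r, s))) (by linarith) hr
      (fun y => by
        have h := (hUV y s).fun_pow 2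
        refine h.congr_deriv ?_
        push_cast; ring)
      (by fun_prop)
    have h2 : δ - -δ = 2 * δ := by ring
    simpa [abs_mul, intervalIntegral.integral_const_mul, h2] using h
  have hc1 : Continuous fun s => ∫ r in (-δ)..δ, U (r, s) ^ 2 :=
    intervalIntegral.continuous_parametric_intervalIntegral_of_continuous' (by fun_prop) _ _
  have hc2 : Continuous fun s => ∫ r in (-δ)..δ, |U (r, s) * V (r, s)| :=
    intervalIntegral.continuous_parametric_intervalIntegral_of_continuous' (by fun_prop) _ _
  have hmono := intervalIntegral.integral_mono (μ := volume) zero_le_one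
    (Continuous.intervalIntegrable (by fun_prop) _ _)
    (Continuous.intervalIntegrable (by fun_prop) _ _) hslice
  rw [intervalIntegral.integral_add (Continuous.intervalIntegrable (by fun_prop) _ _)
      (Continuous.intervalIntegrable (by fun_prop) _ _),
    intervalIntegral.integral_const_mul, intervalIntegral.integral_const_mul,
    ← setIntegral_Qset_symm (g := fun p => U p ^ 2) (by fun_prop) hδ,
    ← setIntegral_Qset_symm (g := fun p => |U p * V p|) (by fun_prop) hδ] at hmono
  have hcs := integral_abs_mul_le_sqrt_mul_sqrt (hU.memLp_two_Qset δ) (hV.memLp_two_Qset δ)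
  linarith

/-- Pointwise bound on a slice `{r} × [0, 1]` by the `H¹` norm of the slice. -/
lemma abs_le_sqrt_integral_slice {f f' : ℝ → ℝ} (hf : ∀ s, HasDerivAt f (f' s) s)
    (hf' : Continuous f') {s : ℝ} (hs : s ∈ Set.Icc (0 : ℝ) 1) :
    |f s| ≤ √(2 * (∫ t in (0 : ℝ)..1, f t ^ 2) + ∫ t in (0 : ℝ)..1, f' t ^ 2) := by
  have hfc : Continuous f := continuous_iff_continuousAt.2 fun y => (hf y).continuousAt
  refine Real.abs_le_sqrt ?_
  have h := le_mean_add_integral_abs_deriv (f := fun t => f t ^ 2)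
    (f' := fun t => 2 * (f t * f' t)) zero_lt_one hs
    (fun y => ((hf y).fun_pow 2).congr_deriv (by push_cast; ring)) (by fun_prop)
  have hmono : ∫ t in (0 : ℝ)..1, |2 * (f t * f' t)| ≤ ∫ t in (0 : ℝ)..1, (f t ^ 2 + f' t ^ 2) := by
    refine intervalIntegral.integral_mono zero_le_one
      (Continuous.intervalIntegrable (by fun_prop) _ _)
      (Continuous.intervalIntegrable (by fun_prop) _ _) fun t => ?_
    refine abs_le.2 ⟨?_, ?_⟩ <;> nlinarith [sq_nonneg (f t - f' t), sq_nonneg (f t + f' t)]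
  rw [intervalIntegral.integral_add (Continuous.intervalIntegrable (by fun_prop) _ _)
      (Continuous.intervalIntegrable (by fun_prop) _ _)] at hmono
  rw [sub_zero, inv_one, one_mul] at h
  linarith

lemma integral_abs_cube_Qset_le {U V W : ℝ × ℝ → ℝ} (hU : Continuous U) (hV : Continuous V)
    (hW : Continuous W) (hUV : ∀ r s, HasDerivAt (fun r => U (r, s)) (V (r, s)) r)
    (hUW : ∀ r s, HasDerivAt (fun s => U (r, s)) (W (r, s)) s) {δ : ℝ} (hδ : 0 < δ) :
    ∫ p in Qset δ, |U p| ^ 3 ≤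
      √((2 * δ)⁻¹ * (∫ p in Qset δ, U p ^ 2) +
          2 * (√(∫ p in Qset δ, U p ^ 2) * √(∫ p in Qset δ, V p ^ 2))) *
        (√(2 * (∫ p in Qset δ, U p ^ 2) + ∫ p in Qset δ, W p ^ 2) *
          √(∫ p in Qset δ, U p ^ 2)) := by
  set K := (2 * δ)⁻¹ * (∫ p in Qset δ, U p ^ 2) +
    2 * (√(∫ p in Qset δ, U p ^ 2) * √(∫ p in Qset δ, V p ^ 2))
  set F : ℝ → ℝ := fun r => ∫ s in (0 : ℝ)..1, U (r, s) ^ 2 with hF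
  set G : ℝ → ℝ := fun r => ∫ s in (0 : ℝ)..1, W (r, s) ^ 2 with hG
  have hFc : Continuous F :=
    intervalIntegral.continuous_parametric_intervalIntegral_of_continuous' (by fun_prop) _ _
  have hGc : Continuous G :=
    intervalIntegral.continuous_parametric_intervalIntegral_of_continuous' (by fun_prop) _ _
  have hF0 : ∀ r, 0 ≤ F r := fun r =>
    intervalIntegral.integral_nonneg zero_le_one fun s _ => sq_nonneg _
  have hG0 : ∀ r, 0 ≤ G r := fun r =>
    intervalIntegral.integral_nonneg zero_le_one fun s _ => sq_nonneg _
  have hle : -δ ≤ δ := by linarith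
  have hN : Continuous fun r => √(2 * F r + G r) := by fun_prop
  have hS : Continuous fun r => √(F r) := by fun_prop
  have hslice : ∀ r ∈ Set.Icc (-δ) δ,
      ∫ s in (0 : ℝ)..1, |U (r, s)| ^ 3 ≤ √K * |√(2 * F r + G r) * √(F r)| := by
    intro r hr
    have h1 : ∫ s in (0 : ℝ)..1, |U (r, s)| ^ 3 ≤
        ∫ s in (0 : ℝ)..1, √(2 * F r + G r) * U (r, s) ^ 2 := by
      refine intervalIntegral.integral_mono_on zero_le_one
        (Continuous.intervalIntegrable (by fun_prop) _ _)
        (Continuous.intervalIntegrable (by fun_prop) _ _) fun s hs => ?_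
      rw [pow_succ', sq_abs]
      exact mul_le_mul_of_nonneg_right
        (abs_le_sqrt_integral_slice (hUW r) (by fun_prop) hs) (sq_nonneg _)
    rw [intervalIntegral.integral_const_mul] at h1
    refine h1.trans ?_
    have h2 : √(F r) ≤ √K := Real.sqrt_le_sqrt (integral_slice_sq_le hU hV hUV hδ hr)
    rw [abs_of_nonneg (by positivity)]
    calc √(2 * F r + G r) * F r = √(F r) * (√(2 * F r + G r) * √(F r)) := by
          nth_rewrite 2 [← Real.mul_self_sqrt (hF0 r)]; ring
      _ ≤ _ := by gcongr
  have hc3 : Continuous fun r => ∫ s in (0 : ℝ)..1, |U (r, s)| ^ 3 :=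
    intervalIntegral.continuous_parametric_intervalIntegral_of_continuous' (by fun_prop) _ _
  rw [setIntegral_Qset (g := fun p => |U p| ^ 3) (by fun_prop) hδ]
  refine (intervalIntegral.integral_mono_on hle (hc3.intervalIntegrable _ _)
    (Continuous.intervalIntegrable (by fun_prop) _ _) hslice).trans ?_
  rw [intervalIntegral.integral_const_mul]
  refine mul_le_mul_of_nonneg_left ?_ (Real.sqrt_nonneg _)
  have hcs := integral_abs_mul_le_sqrt_mul_sqrt (hN.memLp_two_Ioc (-δ) δ) (hS.memLp_two_Ioc (-δ) δ)
  have e1 : ∀ r, √(2 * F r + G r) ^ 2 = 2 * F r + G r := fun r =>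
    Real.sq_sqrt (by linarith [hF0 r, hG0 r])
  have e2 : ∀ r, √(F r) ^ 2 = F r := fun r => Real.sq_sqrt (hF0 r)
  simp only [e1, e2, ← intervalIntegral.integral_of_le hle] at hcs
  rwa [intervalIntegral.integral_add (Continuous.intervalIntegrable (by fun_prop) _ _)
      (Continuous.intervalIntegrable (by fun_prop) _ _), intervalIntegral.integral_const_mul,
    hF, hG, ← setIntegral_Qset (g := fun p => U p ^ 2) (by fun_prop) hδ,
    ← setIntegral_Qset (g := fun p => W p ^ 2) (by fun_prop) hδ] at hcs

theorem anisotropic_L3_estimate (δ : ℝ) (hδ : 0 < δ) :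
    ∃ C > (0 : ℝ), ∀ u : ℝ → ℝ → ℝ,
      ContDiff ℝ 1 (Function.uncurry u) →
      (∀ r s : ℝ, u r (s + 1) = u r s) →
      (∫ p in Qset δ, |u p.1 p.2| ^ 3) ≤
        C * (Real.sqrt (∫ p in Qset δ, (u p.1 p.2) ^ 2) +
              Real.sqrt (∫ p in Qset δ, (deriv (fun r => u r p.2) p.1) ^ 2)) ^ ((1 : ℝ) / 2) *
            (Real.sqrt (∫ p in Qset δ, (u p.1 p.2) ^ 2) +
              Real.sqrt (∫ p in Qset δ, (deriv (u p.1) p.2) ^ 2)) *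
            (Real.sqrt (∫ p in Qset δ, (u p.1 p.2) ^ 2)) ^ ((3 : ℝ) / 2) := by
  refine ⟨2 * √((2 * δ)⁻¹ + 2), by positivity, fun u hu _ => ?_⟩
  have hd : ∀ p, HasFDerivAt (Function.uncurry u) (fderiv ℝ (Function.uncurry u) p) p := fun p =>
    (hu.differentiable one_ne_zero p).hasFDerivAt
  have hr : ∀ r s, HasDerivAt (fun r => Function.uncurry u (r, s))
      (fderiv ℝ (Function.uncurry u) (r, s) (1, 0)) r := fun r s =>
    HasFDerivAt.comp_hasDerivAt (f := fun r => (r, s)) r (hd (r, s)) ((hasDerivAt_id r).prodMk (hasDerivAt_const r s))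
  have hs : ∀ r s, HasDerivAt (fun s => Function.uncurry u (r, s))
      (fderiv ℝ (Function.uncurry u) (r, s) (0, 1)) s := fun r s =>
    HasFDerivAt.comp_hasDerivAt (f := fun s => (r, s)) s (hd (r, s)) ((hasDerivAt_const s r).prodMk (hasDerivAt_id s))
  have hc : Continuous (fderiv ℝ (Function.uncurry u)) := hu.continuous_fderiv one_ne_zero
  have key := integral_abs_cube_Qset_le (U := Function.uncurry u) hu.continuous
    (hc.clm_apply continuous_const) (hc.clm_apply continuous_const) hr hs hδ
  have er : ∀ p : ℝ × ℝ, deriv (fun r => u r p.2) p.1 =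
      fderiv ℝ (Function.uncurry u) p (1, 0) := fun p => (hr p.1 p.2).deriv
  have es : ∀ p : ℝ × ℝ, deriv (u p.1) p.2 =
      fderiv ℝ (Function.uncurry u) p (0, 1) := fun p => (hs p.1 p.2).deriv
  simp only [er, es]
  change ∫ p in Qset δ, |Function.uncurry u p| ^ 3 ≤
    2 * √((2 * δ)⁻¹ + 2) * (√(∫ p in Qset δ, Function.uncurry u p ^ 2) + _) ^ ((1 : ℝ) / 2) *
      (√(∫ p in Qset δ, Function.uncurry u p ^ 2) + _) *
      √(∫ p in Qset δ, Function.uncurry u p ^ 2) ^ ((3 : ℝ) / 2)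
  refine key.trans ?_
  have hA : 0 ≤ ∫ p in Qset δ, Function.uncurry u p ^ 2 := integral_nonneg fun _ => sq_nonneg _
  have hD : 0 ≤ ∫ p in Qset δ, (fderiv ℝ (Function.uncurry u) p (0, 1)) ^ 2 :=
    integral_nonneg fun _ => sq_nonneg _
  rw [← Real.sq_sqrt hA, ← Real.sq_sqrt hD]
  simp only [Real.sqrt_sq (Real.sqrt_nonneg _)]
  set a := √(∫ p in Qset δ, Function.uncurry u p ^ 2)
  set b := √(∫ p in Qset δ, (fderiv ℝ (Function.uncurry u) p (1, 0)) ^ 2)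
  set d := √(∫ p in Qset δ, (fderiv ℝ (Function.uncurry u) p (0, 1)) ^ 2)
  have ha : 0 ≤ a := Real.sqrt_nonneg _
  have hb : 0 ≤ b := Real.sqrt_nonneg _
  have hd : 0 ≤ d := Real.sqrt_nonneg _
  clear_value a b d
  have h1 : √((2 * δ)⁻¹ * a ^ 2 + 2 * (a * b)) ≤
      √((2 * δ)⁻¹ + 2) * (√a * (a + b) ^ ((1 : ℝ) / 2)) := by
    rw [← Real.sqrt_eq_rpow, ← Real.sqrt_mul ha, ← Real.sqrt_mul (by positivity)]
    refine Real.sqrt_le_sqrt ?_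
    have h : 0 ≤ (2 * δ)⁻¹ * (a * b) + 2 * a ^ 2 := by positivity
    nlinarith
  have h2 : √(2 * a ^ 2 + d ^ 2) ≤ 2 * (a + d) :=
    Real.sqrt_le_iff.2 ⟨by positivity, by nlinarith [mul_nonneg ha hd]⟩
  have h3 : a ^ ((3 : ℝ) / 2) = a * √a := by
    rw [Real.sqrt_eq_rpow, show (3 : ℝ) / 2 = 1 + 1 / 2 by norm_num,
      Real.rpow_add_of_nonneg ha (by norm_num) (by norm_num), Real.rpow_one]
  rw [h3]
  calc _ ≤ (√((2 * δ)⁻¹ + 2) * (√a * (a + b) ^ ((1 : ℝ) / 2))) * (2 * (a + d) * a) := by gcongr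
    _ = _ := by ring
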